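/- For every positive integer k there exists a balanced edge-coloring of K_{13^k} with 6 colors containing no rainbow K_4. -/

import Mathlib

/-- An edge-coloring (given as a symmetric function) is balanced if every vertex is
incident to each color the same number of times. -/
def IsBalanced {n ℓ : ℕ} (c : Fin n → Fin n → Fin ℓ) : Prop :=
  (∀ i j, c i j = c j i) ∧
  ∃ t : ℕ, ∀ v : Fin n, ∀ col : Fin ℓ,
    (Finset.univ.filter (fun j => j ≠ v ∧ c v j = col)).card = t

/-- The set `s` is rainbow for the coloring `c`: distinct edges inside `s` get
distinct colors. -/
def IsRainbowOn {V : Type*} [DecidableEq V] {ℓ : ℕ} (c : V → V → Fin ℓ)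
    (s : Finset V) : Prop :=
  ∀ a ∈ s, ∀ b ∈ s, ∀ a' ∈ s, ∀ b' ∈ s,
    a ≠ b → a' ≠ b' → ({a, b} : Finset V) ≠ {a', b'} → c a b ≠ c a' b'

/-- The coloring `c` contains a rainbow copy of K_q. -/
def HasRainbowClique {V : Type*} [DecidableEq V] {ℓ : ℕ} (c : V → V → Fin ℓ)
    (q : ℕ) : Prop :=
  ∃ s : Finset V, s.card = q ∧ IsRainbowOn c s

/-- The six edges spanned by `a, b, c, d` have pairwise distinct colors. Degenerate quadruples
never satisfy this for a symmetric coloring, since two edges then share a color. -/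
abbrev IsRainbowQuadruple {V C : Type*} (f : V → V → C) (a b c d : V) : Prop :=
  [f a b, f a c, f a d, f b c, f b d, f c d].Nodup

/-- A symmetric 6-coloring on `V` in which every vertex sees each color `t` times and which has
no rainbow quadruple. -/
structure IsBalancedRainbowFree {V : Type*} [Fintype V] [DecidableEq V]
    (f : V → V → Fin 6) (t : ℕ) : Prop where
  symm : ∀ x y, f x y = f y x
  card_eq : ∀ v col, (Finset.univ.filter (fun w => w ≠ v ∧ f v w = col)).card = t
  not_rainbow : ∀ a b c d, ¬ IsRainbowQuadruple f a b c d

/-- The lexicographic product of two colorings. -/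
def lexColoring {V W C : Type*} [DecidableEq V] (f : V → V → C) (g : W → W → C)
    (p q : V × W) : C :=
  if p.1 = q.1 then g p.2 q.2 else f p.1 q.1

theorem IsBalancedRainbowFree.lexColoring {V W : Type*} [Fintype V] [DecidableEq V] [Fintype W]
    [DecidableEq W] {f : V → V → Fin 6} {g : W → W → Fin 6} {s t : ℕ}
    (hf : IsBalancedRainbowFree f s) (hg : IsBalancedRainbowFree g t) :
    IsBalancedRainbowFree (lexColoring f g) (t + s * Fintype.card W) where
  symm p q := by
    simp only [_root_.lexColoring, eq_comm (a := q.1), hf.symm q.1, hg.symm q.2]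
  card_eq := by
    rintro ⟨v, w⟩ col
    have hsplit : Finset.univ.filter
          (fun q : V × W => q ≠ (v, w) ∧ _root_.lexColoring f g (v, w) q = col) =
        ({v} ×ˢ Finset.univ.filter (fun y => y ≠ w ∧ g w y = col)) ∪
          (Finset.univ.filter (fun x => x ≠ v ∧ f v x = col)) ×ˢ Finset.univ := by
      ext ⟨x, y⟩
      by_cases h : x = v
      · subst h
        simp [_root_.lexColoring]
      · simp [_root_.lexColoring, h, Ne.symm h]
    rw [hsplit, Finset.card_union_of_disjoint, Finset.card_product, Finset.card_product,
      hf.card_eq, hg.card_eq, Finset.card_singleton, one_mul, Finset.card_univ]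
    rw [Finset.disjoint_left]
    rintro ⟨x, y⟩ hx hx'
    simp_all
  not_rainbow := by
    rintro ⟨a, a'⟩ ⟨b, b'⟩ ⟨c, c'⟩ ⟨d, d'⟩ h
    have hF := hf.not_rainbow a b c d
    have hG := hg.not_rainbow a' b' c' d'
    have hs := hf.symm
    simp only [IsRainbowQuadruple, _root_.lexColoring, List.nodup_cons, List.mem_cons,
      List.not_mem_nil, or_false, not_or, not_false_eq_true, List.nodup_nil, and_true] at h hF hG
    by_cases hab : a = b <;> by_cases hac : a = c <;> by_cases had : a = d <;>
      by_cases hbc : b = c <;> by_cases hbd : b = d <;> by_cases hcd : c = d <;> grind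

theorem IsBalancedRainbowFree.comp_equiv {V W : Type*} [Fintype V] [DecidableEq V] [Fintype W]
    [DecidableEq W] {f : V → V → Fin 6} {t : ℕ} (hf : IsBalancedRainbowFree f t) (e : W ≃ V) :
    IsBalancedRainbowFree (fun x y => f (e x) (e y)) t where
  symm x y := hf.symm _ _
  card_eq v col := by
    rw [← hf.card_eq (e v) col]
    exact Finset.card_equiv e (by simp)
  not_rainbow a b c d := hf.not_rainbow _ _ _ _

/-- On `ℤ/12 ∪ {∞}`, with `∞ = 12`: translating by one shifts all the colors by one
modulo 6. -/
def cyclicColoring (x y : Fin 13) : Fin 6 :=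
  if x = 12 then Fin.ofNat 6 y
  else if y = 12 then Fin.ofNat 6 x
  else Fin.ofNat 6 (x + [0, 5, 3, 5, 4, 2, 1, 3, 0, 2, 1, 4].getD ((y + 12 - x : ℕ) % 12) 0)

/-- A rainbow quadruple uses every color exactly once, so its color bit masks add up to `63`. -/
theorem IsRainbowQuadruple.sum_two_pow {V : Type*} {f : V → V → Fin 6} {a b c d : V}
    (h : IsRainbowQuadruple f a b c d) :
    2 ^ (f a b).val + 2 ^ (f a c).val + 2 ^ (f a d).val + 2 ^ (f b c).val + 2 ^ (f b d).val +
      2 ^ (f c d).val = 63 := by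
  have huniv := Finset.eq_univ_of_card _ ((List.toFinset_card_of_nodup h).trans (by simp))
  have hsum := List.sum_toFinset (fun x : Fin 6 => 2 ^ x.val) h
  rw [huniv] at hsum
  simpa [Fin.sum_univ_succ, add_assoc] using hsum.symm

theorem isBalancedRainbowFree_cyclicColoring : IsBalancedRainbowFree cyclicColoring 2 where
  symm := by decide +kernel
  card_eq := by decide +kernel
  not_rainbow a b c d h := by
    have hne : ∀ a b c d, 2 ^ (cyclicColoring a b).val + 2 ^ (cyclicColoring a c).val +
        2 ^ (cyclicColoring a d).val + 2 ^ (cyclicColoring b c).val +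
        2 ^ (cyclicColoring b d).val + 2 ^ (cyclicColoring c d).val ≠ 63 := by
      decide +kernel
    exact hne a b c d h.sum_two_pow

theorem exists_isBalancedRainbowFree_pow (k : ℕ) :
    ∃ (f : Fin (13 ^ k) → Fin (13 ^ k) → Fin 6) (t : ℕ), IsBalancedRainbowFree f t := by
  induction k with
  | zero => exact ⟨fun _ _ => 0, 0, by decide, by decide, by decide⟩
  | succ k ih =>
    obtain ⟨f, t, hf⟩ := ih
    exact ⟨_, _, (hf.lexColoring isBalancedRainbowFree_cyclicColoring).comp_equiv
      (Fintype.equivOfCardEq (by simp [pow_succ]))⟩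

theorem HasRainbowClique.exists_isRainbowQuadruple {V : Type*} [DecidableEq V] {ℓ : ℕ}
    {f : V → V → Fin ℓ} (h : HasRainbowClique f 4) :
    ∃ a b c d, IsRainbowQuadruple f a b c d := by
  obtain ⟨s, hs, h⟩ := h
  obtain ⟨a, b, c, d, hab, hac, had, hbc, hbd, hcd, rfl⟩ := Finset.card_eq_four.1 hs
  have key : ∀ x ∈ ({a, b, c, d} : Finset V), ∀ y ∈ ({a, b, c, d} : Finset V),
      ∀ x' ∈ ({a, b, c, d} : Finset V), ∀ y' ∈ ({a, b, c, d} : Finset V),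
      x ≠ y → x' ≠ y' → ¬ ((x = x' ∨ x = y') ∧ (y = x' ∨ y = y')) → f x y ≠ f x' y' := by
    intro x hx y hy x' hx' y' hy' hxy hxy' hne
    refine h x hx y hy x' hx' y' hy' hxy hxy' fun heq => hne ?_
    have h₁ : x ∈ ({x', y'} : Finset V) := heq ▸ by simp
    have h₂ : y ∈ ({x', y'} : Finset V) := heq ▸ by simp
    exact ⟨by simpa using h₁, by simpa using h₂⟩
  refine ⟨a, b, c, d, ?_⟩
  simp only [IsRainbowQuadruple, List.nodup_cons, List.mem_cons,
    List.not_mem_nil, or_false, not_or, not_false_eq_true, List.nodup_nil, and_true]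
  refine ⟨⟨?_, ?_, ?_, ?_, ?_⟩, ⟨?_, ?_, ?_, ?_⟩, ⟨?_, ?_, ?_⟩, ⟨?_, ?_⟩, ?_⟩ <;>
    apply key <;> simp [*, Ne.symm, eq_comm]

/-- For every k ≥ 1 there is a balanced 6-coloring of K_{13^k} with no rainbow K₄. -/
theorem balanced_6coloring_13_pow_no_rainbow_K4 :
    ∀ k : ℕ, 0 < k →
      ∃ c : Fin (13 ^ k) → Fin (13 ^ k) → Fin 6,
        IsBalanced c ∧ ¬ HasRainbowClique c 4 := by
  intro k _
  obtain ⟨f, t, hf⟩ := exists_isBalancedRainbowFree_pow k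
  refine ⟨f, ⟨hf.symm, t, hf.card_eq⟩, fun h => ?_⟩
  obtain ⟨a, b, c, d, habcd⟩ := h.exists_isRainbowQuadruple
  exact hf.not_rainbow a b c d habcd
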